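/- Let ι be a finite type, f : Finset ι → ℝ monotone and submodular with f(∅) = 0, and let N ≥ 1. Let S_N be the set produced after N steps of the greedy algorithm (S₀ = ∅, S_{i+1} = insert x_i S_i with x_i maximizing the marginal gain f(insert x S_i) - f(S_i) over x ∈ ι). Then for every finset O with |O| ≤ N and f(O) > 0, (f(O) - f(S_N)) / f(O) ≤ ((N - 1)/N)^N. -/

import Mathlib

/-- For a monotone submodular function, the gain of adding a set is at most the sum of the
marginal gains of its elements. -/
theorem submodular_union_sub_le_sum {ι : Type*} [DecidableEq ι] (f : Finset ι → ℝ)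
    (hmono : ∀ S T : Finset ι, S ⊆ T → f S ≤ f T)
    (hsub : ∀ S T : Finset ι, S ⊆ T → ∀ x ∉ T,
      f (insert x S) - f S ≥ f (insert x T) - f T)
    (S T : Finset ι) :
    f (T ∪ S) - f S ≤ ∑ y ∈ T, (f (insert y S) - f S) := by
  induction T using Finset.induction_on with
  | empty => simp
  | insert a T ha ih =>
    rw [Finset.sum_insert ha, Finset.insert_union]
    by_cases h : a ∈ T ∪ S
    · rw [Finset.insert_eq_of_mem h]
      linarith [hmono S (insert a S) (Finset.subset_insert a S)]
    · linarith [hsub S (T ∪ S) Finset.subset_union_right a h]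

/-- One greedy step closes at least a `1 / N` fraction of the gap to any set with at most `N`
elements. -/
theorem submodular_gap_insert_le {ι : Type*} [DecidableEq ι] (f : Finset ι → ℝ)
    (hmono : ∀ S T : Finset ι, S ⊆ T → f S ≤ f T)
    (hsub : ∀ S T : Finset ι, S ⊆ T → ∀ x ∉ T,
      f (insert x S) - f S ≥ f (insert x T) - f T)
    (N : ℕ) (hN : 1 ≤ N) (S : Finset ι) (x : ι)
    (hgreedy : ∀ y : ι, f (insert y S) - f S ≤ f (insert x S) - f S)
    (O : Finset ι) (hO : O.card ≤ N) :
    f O - f (insert x S) ≤ ((N : ℝ) - 1) / N * (f O - f S) := by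
  have hN0 : (0 : ℝ) < N := by exact_mod_cast hN
  have hgain : 0 ≤ f (insert x S) - f S :=
    sub_nonneg.2 (hmono _ _ (Finset.subset_insert x S))
  have hsum : ∑ y ∈ O, (f (insert y S) - f S) ≤ O.card * (f (insert x S) - f S) := by
    simpa only [nsmul_eq_mul] using Finset.sum_le_card_nsmul O _ _ fun y _ => hgreedy y
  have hcard : (O.card : ℝ) * (f (insert x S) - f S) ≤ N * (f (insert x S) - f S) := by
    gcongr
  have hgap : f O - f S ≤ N * (f (insert x S) - f S) := by
    linarith [submodular_union_sub_le_sum f hmono hsub S O,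
      hmono O (O ∪ S) Finset.subset_union_left]
  rw [div_mul_eq_mul_div, le_div_iff₀ hN0]
  linarith

/-- Classical Nemhauser–Wolsey–Fisher approximation bound for the greedy algorithm on a
monotone submodular function with `f(∅) = 0`: after `N` greedy steps, for any finset `O`
with `|O| ≤ N` and `f(O) > 0`, the relative residual gap is at most `((N-1)/N)^N`. -/
theorem greedy_approximation_bound {ι : Type*} [Fintype ι] [DecidableEq ι]
    (f : Finset ι → ℝ)
    (hmono : ∀ S T : Finset ι, S ⊆ T → f S ≤ f T)
    (hsub : ∀ S T : Finset ι, S ⊆ T → ∀ x ∉ T,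
      f (insert x S) - f S ≥ f (insert x T) - f T)
    (hf0 : f ∅ = 0)
    (N : ℕ) (hN : 1 ≤ N)
    (S : ℕ → Finset ι) (x : ℕ → ι)
    (hS0 : S 0 = ∅)
    (hSsucc : ∀ i, S (i + 1) = insert (x i) (S i))
    (hgreedy : ∀ i, ∀ y : ι,
      f (insert y (S i)) - f (S i) ≤ f (insert (x i) (S i)) - f (S i))
    (O : Finset ι) (hO : O.card ≤ N) (hfO : 0 < f O) :
    (f O - f (S N)) / f O ≤ (((N : ℝ) - 1) / N) ^ N := by
  have hr : 0 ≤ ((N : ℝ) - 1) / N :=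
    div_nonneg (sub_nonneg.2 (by exact_mod_cast hN)) (Nat.cast_nonneg N)
  have hgap (k : ℕ) : f O - f (S k) ≤ (((N : ℝ) - 1) / N) ^ k * f O := by
    induction k with
    | zero => simp [hS0, hf0]
    | succ k ih =>
      rw [hSsucc, pow_succ', mul_assoc]
      exact (submodular_gap_insert_le f hmono hsub N hN (S k) (x k) (hgreedy k) O hO).trans
        (mul_le_mul_of_nonneg_left ih hr)
  exact (div_le_iff₀ hfO).2 (hgap N)
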